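/- Let β = 0, 0 < α < 8/(d+n), and let u_λ minimize m_{1,λ}. Then u_λ satisfies the Pohozaev-type identity 2‖Δ_x u_λ‖₂² = (αd/(2(α+2))) ‖u_λ‖_{α+2}^{α+2}. -/

import Mathlib

noncomputable section

open MeasureTheory Real Filter Set

namespace BNLS

/-- A point of `ℝ^d × 𝕋^n`, the torus being modelled by periodic functions on `ℝ^n`. -/
abbrev Pt (d n : ℕ) := (Fin d → ℝ) × (Fin n → ℝ)

/-- Fundamental domain `[0,2π)^n` of the torus `(ℝ/2πℤ)^n`. -/
def torusBox (n : ℕ) : Set (Fin n → ℝ) := Set.univ.pi fun _ => Set.Ico 0 (2*π)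

/-- The measure of the torus `𝕋^n`. -/
def μT (n : ℕ) : Measure (Fin n → ℝ) := volume.restrict (torusBox n)

/-- The measure of `ℝ^d × 𝕋^n`. -/
def μP (d n : ℕ) : Measure (Pt d n) := (volume : Measure (Fin d → ℝ)).prod (μT n)

/-- Partial derivative in the `i`-th `x`-direction. -/
def dX (d n : ℕ) (i : Fin d) (u : Pt d n → ℂ) : Pt d n → ℂ :=
  fun p => fderiv ℝ u p (Pi.single i 1, 0)

/-- Partial derivative in the `j`-th `y`-direction. -/
def dY (d n : ℕ) (j : Fin n) (u : Pt d n → ℂ) : Pt d n → ℂ :=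
  fun p => fderiv ℝ u p (0, Pi.single j 1)

/-- Partial Laplacian `Δ_x`. -/
def lapX (d n : ℕ) (u : Pt d n → ℂ) : Pt d n → ℂ := fun p => ∑ i, dX d n i (dX d n i u) p

/-- Partial Laplacian `Δ_y`. -/
def lapY (d n : ℕ) (u : Pt d n → ℂ) : Pt d n → ℂ := fun p => ∑ j, dY d n j (dY d n j u) p

/-- Full Laplacian `Δ_{x,y}`. -/
def lap (d n : ℕ) (u : Pt d n → ℂ) : Pt d n → ℂ := fun p => lapX d n u p + lapY d n u p

/-- Mass `‖u‖_{L²}²`. -/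
def Mass (d n : ℕ) (u : Pt d n → ℂ) : ℝ := ∫ z, ‖u z‖^2 ∂(μP d n)

/-- `‖u‖_{L^p}^p`. -/
def Npow (d n : ℕ) (p : ℝ) (u : Pt d n → ℂ) : ℝ := ∫ z, ‖u z‖ ^ p ∂(μP d n)

/-- The `L^p` norm. -/
def LpN (d n : ℕ) (p : ℝ) (u : Pt d n → ℂ) : ℝ := (Npow d n p u) ^ (1/p)

/-- `‖Δ u‖_{L²}²`. -/
def lapSq (d n : ℕ) (u : Pt d n → ℂ) : ℝ := ∫ z, ‖lap d n u z‖^2 ∂(μP d n)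

/-- `‖Δ_x u‖_{L²}²`. -/
def lapXSq (d n : ℕ) (u : Pt d n → ℂ) : ℝ := ∫ z, ‖lapX d n u z‖^2 ∂(μP d n)

/-- `‖Δ_y u‖_{L²}²`. -/
def lapYSq (d n : ℕ) (u : Pt d n → ℂ) : ℝ := ∫ z, ‖lapY d n u z‖^2 ∂(μP d n)

/-- `‖∇_x u‖_{L²}²`. -/
def gradXSq (d n : ℕ) (u : Pt d n → ℂ) : ℝ := ∫ z, (∑ i, ‖dX d n i u z‖^2) ∂(μP d n)

/-- `‖∇_y u‖_{L²}²`. -/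
def gradYSq (d n : ℕ) (u : Pt d n → ℂ) : ℝ := ∫ z, (∑ j, ‖dY d n j u z‖^2) ∂(μP d n)

/-- `‖∇ u‖_{L²}²`. -/
def gradSq (d n : ℕ) (u : Pt d n → ℂ) : ℝ := gradXSq d n u + gradYSq d n u

/-- Pointwise sum of squares of all second derivatives. -/
def hessInt (d n : ℕ) (u : Pt d n → ℂ) (z : Pt d n) : ℝ :=
  (∑ i, ∑ i', ‖dX d n i (dX d n i' u) z‖^2) + (∑ i, ∑ j, ‖dY d n j (dX d n i u) z‖^2)
  + (∑ j, ∑ i, ‖dX d n i (dY d n j u) z‖^2) + (∑ j, ∑ j', ‖dY d n j (dY d n j' u) z‖^2)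

/-- `‖∇² u‖_{L²}²`. -/
def hessSq (d n : ℕ) (u : Pt d n → ℂ) : ℝ := ∫ z, hessInt d n u z ∂(μP d n)

/-- The `H²` norm on `ℝ^d × 𝕋^n`. -/
def H2norm (d n : ℕ) (u : Pt d n → ℂ) : ℝ :=
  Real.sqrt (Mass d n u + gradSq d n u + hessSq d n u)

/-- `2π`-periodicity in all `y`-variables. -/
def Periodic (d n : ℕ) (u : Pt d n → ℂ) : Prop :=
  ∀ j : Fin n, ∀ p : Pt d n, u (p.1, p.2 + (2*π) • (Pi.single j 1 : Fin n → ℝ)) = u p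

/-- Membership in `H²(ℝ^d × 𝕋^n)`. -/
def InH2 (d n : ℕ) (u : Pt d n → ℂ) : Prop :=
  ContDiff ℝ 2 u ∧ Periodic d n u ∧
  Integrable (fun z => ‖u z‖^2) (μP d n) ∧
  Integrable (fun z => (∑ i, ‖dX d n i u z‖^2) + ∑ j, ‖dY d n j u z‖^2) (μP d n) ∧
  Integrable (hessInt d n u) (μP d n)

/-- The mass sphere `S(c)`. -/
def Sset (d n : ℕ) (c : ℝ) : Set (Pt d n → ℂ) := {u | InH2 d n u ∧ Mass d n u = c}

/-- The energy functional `E`. -/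
def En (d n : ℕ) (β α : ℝ) (u : Pt d n → ℂ) : ℝ :=
  (1/2) * lapSq d n u + (β/2) * gradSq d n u - (1/(α+2)) * Npow d n (α+2) u

/-- The ground state energy `m_c`. -/
def mC (d n : ℕ) (β α c : ℝ) : ℝ := sInf (En d n β α '' Sset d n c)

end BNLS

namespace BNLS

/-- The rescaled energy `E_λ` (case `β = 0`). -/
def Elam (d n : ℕ) (lam α : ℝ) (u : Pt d n → ℂ) : ℝ :=
  (lam/2) * lapYSq d n u + (1/2) * lapXSq d n u - (1/(α+2)) * Npow d n (α+2) u

/-- The rescaled ground state energy `m_{1,λ}`. -/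
def m1lam (d n : ℕ) (lam α : ℝ) : ℝ := sInf (Elam d n lam α '' Sset d n 1)

end BNLS

section
open scoped Pointwise

namespace BNLS

/-- The lattice hom. -/
def latHom (d n : ℕ) : (Fin n → ℤ) →+ Pt d n where
  toFun k := (0, fun j => (k j : ℝ) * (2*π))
  map_zero' := by ext <;> simp
  map_add' a b := by ext <;> simp [add_mul]

/-- The period lattice. -/
def Lat (d n : ℕ) : AddSubgroup (Pt d n) := (latHom d n).range

instance (d n : ℕ) : Countable (Lat d n) := by
  have : Function.Surjective (latHom d n).rangeRestrict := AddMonoidHom.rangeRestrict_surjective _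
  exact this.countable

/-- The domain. -/
def Dom (d n : ℕ) : Set (Pt d n) := univ ×ˢ torusBox n

lemma measurableSet_torusBox (n : ℕ) : MeasurableSet (torusBox n) :=
  MeasurableSet.univ_pi fun _ => measurableSet_Ico

lemma measurableSet_Dom (d n : ℕ) : MeasurableSet (Dom d n) :=
  MeasurableSet.univ.prod (measurableSet_torusBox n)

lemma muP_eq (d n : ℕ) : μP d n = (volume : Measure (Pt d n)).restrict (Dom d n) := by
  rw [μP, μT, Dom, Measure.volume_eq_prod, ← Measure.prod_restrict, Measure.restrict_univ]

lemma isFund (d n : ℕ) : IsAddFundamentalDomain (Lat d n) (Dom d n) (volume : Measure (Pt d n)) := by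
  refine IsAddFundamentalDomain.mk' (measurableSet_Dom d n).nullMeasurableSet fun z => ?_
  have h1 : ∀ j, ∃! m : ℤ, z.2 j + m • (2*π) ∈ Ico (0:ℝ) (0 + 2*π) := fun j =>
    existsUnique_add_zsmul_mem_Ico (by positivity) (z.2 j) 0
  choose m hm hu using h1
  refine ⟨⟨latHom d n m, ⟨m, rfl⟩⟩, ?_, ?_⟩
  · change latHom d n m + z ∈ Dom d n
    refine ⟨trivial, fun j _ => ?_⟩
    have := hm j
    simp only [zero_add, zsmul_eq_mul] at this
    simpa [latHom, add_comm] using this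
  · rintro ⟨_, ⟨k, rfl⟩⟩ hk
    change latHom d n k + z ∈ Dom d n at hk
    have : k = m := by
      funext j
      refine hu j _ ?_
      have := hk.2 j trivial
      simpa [latHom, add_comm] using this
    subst this; rfl

/-- Periodic under the lattice. -/
def Per (d n : ℕ) {X : Type*} (f : Pt d n → X) : Prop := ∀ g ∈ Lat d n, ∀ z, f (g + z) = f z

lemma Per.of_periodic {d n : ℕ} {u : Pt d n → ℂ} (hu : Periodic d n u) : Per d n u := by
  let S : AddSubgroup (Pt d n) :=
    { carrier := {g | ∀ z, u (g + z) = u z}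
      zero_mem' := by intro z; simp
      add_mem' := by
        intro a b ha hb z
        rw [add_assoc, ha, hb]
      neg_mem' := by
        intro a ha z
        rw [← ha (-a + z)]; simp }
  have hS : ∀ j, ((0, (2*π) • (Pi.single j 1 : Fin n → ℝ)) : Pt d n) ∈ S := by
    intro j z
    have := hu j z
    rw [← this]; congr 1; ext <;> simp [add_comm]
  rintro _ ⟨k, rfl⟩
  change latHom d n k ∈ S
  have : latHom d n k = ∑ j, k j • ((0, (2*π) • (Pi.single j 1 : Fin n → ℝ)) : Pt d n) := by
    refine Prod.ext ?_ ?_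
    · simp [latHom, Prod.fst_sum]
    · ext i
      simp [latHom, Prod.snd_sum, Finset.sum_apply, Pi.single_apply, mul_comm]
  rw [this]
  exact S.sum_mem fun j _ => S.zsmul_mem (hS j) _

variable {d n : ℕ}

instance instHaarPt : (volume : Measure (Pt d n)).IsAddHaarMeasure :=
  Measure.prod.instIsAddHaarMeasure (volume : Measure (Fin d → ℝ)) (volume : Measure (Fin n → ℝ))

instance instInvLat : VAddInvariantMeasure (Lat d n) (Pt d n) volume :=
  ⟨fun c s _ => by
    exact measure_preimage_add (volume : Measure (Pt d n)) (c : Pt d n) s⟩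

instance instInvPt : VAddInvariantMeasure (Pt d n) (Pt d n) volume :=
  ⟨fun c s _ => by
    exact measure_preimage_add (volume : Measure (Pt d n)) (c : Pt d n) s⟩

lemma Per.comp {X Y : Type*} {f : Pt d n → X} (hf : Per d n f) (φ : X → Y) :
    Per d n (fun z => φ (f z)) := fun g hg z => by simp only [hf g hg z]

lemma Per.comp₂ {X Y W : Type*} {f : Pt d n → X} {f' : Pt d n → Y} (hf : Per d n f)
    (hf' : Per d n f') (φ : X → Y → W) :
    Per d n (fun z => φ (f z) (f' z)) := fun g hg z => by simp only [hf g hg z, hf' g hg z]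

lemma Per.shift {X : Type*} {f : Pt d n → X} (hf : Per d n f) (k : Pt d n) :
    Per d n (fun z => f (z + k)) := fun g hg z => by simp only [add_assoc, hf g hg]

lemma Per.fderiv {X : Type*} [NormedAddCommGroup X] [NormedSpace ℝ X] {f : Pt d n → X}
    (hf : Per d n f) (e : Pt d n) :
    Per d n (fun z => fderiv ℝ f z e) := fun g hg z => by
  have : f = fun z => f (g + z) := by funext z; rw [hf g hg]
  conv_rhs => rw [this]
  simp only [fderiv_comp_add_left]

lemma isFund_vadd (k : Pt d n) :
    IsAddFundamentalDomain (Lat d n) (k +ᵥ Dom d n) (volume : Measure (Pt d n)) :=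
  (isFund d n).vadd_of_comm k

lemma preimage_vadd (k : Pt d n) : (fun z => z + k) ⁻¹' (k +ᵥ Dom d n) = Dom d n := by
  ext z
  simp [Set.mem_vadd_set, add_comm]

lemma lint_vadd {f : Pt d n → ENNReal} (hf : Per d n f) (k : Pt d n) :
    ∫⁻ z in (k +ᵥ Dom d n), f z = ∫⁻ z, f z ∂(μP d n) := by
  rw [muP_eq]
  exact (isFund_vadd k).setLIntegral_eq (isFund d n) f (fun g x => hf g g.2 x)

lemma lint_shift {f : Pt d n → ENNReal} (hf : Per d n f) (k : Pt d n) :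
    ∫⁻ z, f (z + k) ∂(μP d n) = ∫⁻ z, f z ∂(μP d n) := by
  rw [← lint_vadd hf k, muP_eq]
  have h := ((measurePreserving_add_right (volume : Measure (Pt d n)) k).setLIntegral_comp_preimage_emb
    (MeasurableEquiv.addRight k).measurableEmbedding f (k +ᵥ Dom d n))
  rw [preimage_vadd] at h
  exact h

lemma int_shift {f : Pt d n → ℝ} (hf : Per d n f) (k : Pt d n) :
    ∫ z, f (z + k) ∂(μP d n) = ∫ z, f z ∂(μP d n) := by
  rw [muP_eq, ← (isFund_vadd k).setIntegral_eq (isFund d n) (fun g x => hf g g.2 x)]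
  have h := ((measurePreserving_add_right (volume : Measure (Pt d n)) k).setIntegral_preimage_emb
    (MeasurableEquiv.addRight k).measurableEmbedding f (k +ᵥ Dom d n))
  rw [preimage_vadd] at h
  exact h

lemma integrable_shift {f : Pt d n → ℝ} (hf : Per d n f) (hfc : Continuous f)
    (hi : Integrable f (μP d n)) (k : Pt d n) :
    Integrable (fun z => f (z + k)) (μP d n) := by
  refine ⟨(hfc.comp (continuous_id.add continuous_const)).aestronglyMeasurable, ?_⟩
  have := hi.2
  rw [HasFiniteIntegral] at this ⊢
  rwa [lint_shift (hf.comp (fun x => ‖x‖ₑ)) k]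

instance : SFinite (μP d n) := by rw [muP_eq]; infer_instance

lemma integrable_prod_shift {S : Type*} [TopologicalSpace S] [SecondCountableTopology S]
    [MeasurableSpace S] [OpensMeasurableSpace S] (ν : Measure S) [IsFiniteMeasure ν]
    {f : Pt d n → ℝ} (hf : Per d n f) (hfc : Continuous f)
    (hi : Integrable f (μP d n)) {c : S → Pt d n} (hc : Continuous c) :
    Integrable (fun p : Pt d n × S => f (p.1 + c p.2)) ((μP d n).prod ν) := by
  have hm : Continuous (fun p : Pt d n × S => f (p.1 + c p.2)) := by fun_prop
  refine (integrable_prod_iff' hm.aestronglyMeasurable).2 ⟨?_, ?_⟩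
  · exact Eventually.of_forall fun s => integrable_shift hf hfc hi (c s)
  · have : (fun s => ∫ z, ‖f (z + c s)‖ ∂(μP d n)) = fun _ => ∫ z, ‖f z‖ ∂(μP d n) := by
      funext s
      exact int_shift (hf.comp (fun x => ‖x‖)) (c s)
    simp only [this]
    exact integrable_const _

end BNLS

namespace BNLS
variable {d n : ℕ}

/-- Continuous periodic square integrable functions. -/
structure Good (d n : ℕ) (f : Pt d n → ℂ) : Prop where
  cont : Continuous f
  per : Per d n f
  sq : Integrable (fun z => ‖f z‖^2) (μP d n)

lemma Good.memLp {f : Pt d n → ℂ} (hf : Good d n f) : MemLp f 2 (μP d n) :=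
  (memLp_two_iff_integrable_sq_norm hf.cont.aestronglyMeasurable).2 hf.sq

lemma Good.mk' {f : Pt d n → ℂ} (hc : Continuous f) (hp : Per d n f) (h : MemLp f 2 (μP d n)) :
    Good d n f :=
  ⟨hc, hp, (memLp_two_iff_integrable_sq_norm hc.aestronglyMeasurable).1 h⟩

/-- Shift. -/
def sh (k : Pt d n) (f : Pt d n → ℂ) : Pt d n → ℂ := fun z => f (z + k)

lemma Good.sh {f : Pt d n → ℂ} (hf : Good d n f) (k : Pt d n) : Good d n (sh k f) :=
  ⟨hf.cont.comp (continuous_id.add continuous_const), hf.per.shift k,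
    integrable_shift (hf.per.comp (fun x => ‖x‖^2)) (hf.cont.norm.pow 2) hf.sq k⟩

lemma Good.add {f g : Pt d n → ℂ} (hf : Good d n f) (hg : Good d n g) : Good d n (f + g) :=
  Good.mk' (hf.cont.add hg.cont) (hf.per.comp₂ hg.per (· + ·)) (hf.memLp.add hg.memLp)

lemma Good.sub {f g : Pt d n → ℂ} (hf : Good d n f) (hg : Good d n g) : Good d n (f - g) :=
  Good.mk' (hf.cont.sub hg.cont) (hf.per.comp₂ hg.per (· - ·)) (hf.memLp.sub hg.memLp)

/-- The real `L²` inner product. -/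
def ip (f g : Pt d n → ℂ) : ℝ := ∫ z, inner ℝ (f z) (g z) ∂(μP d n)

lemma integrable_ip {f g : Pt d n → ℂ} (hf : MemLp f 2 (μP d n)) (hg : MemLp g 2 (μP d n)) :
    Integrable (fun z => inner ℝ (f z) (g z)) (μP d n) := by
  have h1 := (memLp_two_iff_integrable_sq_norm hf.1).1 hf
  have h2 := (memLp_two_iff_integrable_sq_norm hg.1).1 hg
  refine (h1.add h2).mono' (hf.1.inner hg.1) (Eventually.of_forall fun z => ?_)
  have := norm_inner_le_norm (𝕜 := ℝ) (f z) (g z)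
  simp only [Pi.add_apply]
  nlinarith [sq_nonneg (‖f z‖ - ‖g z‖), sq_nonneg (‖f z‖), sq_nonneg ‖g z‖]

lemma inner_toLp {f g : Pt d n → ℂ} (hf : MemLp f 2 (μP d n)) (hg : MemLp g 2 (μP d n)) :
    inner ℝ (hf.toLp f) (hg.toLp g) = ip f g := by
  rw [L2.inner_def, ip]
  refine integral_congr_ae ?_
  filter_upwards [hf.coeFn_toLp, hg.coeFn_toLp] with z h1 h2
  rw [h1, h2]

lemma ip_self (f : Pt d n → ℂ) : ip f f = ∫ z, ‖f z‖^2 ∂(μP d n) := by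
  simp only [ip, real_inner_self_eq_norm_sq]

lemma ip_comm (f g : Pt d n → ℂ) : ip f g = ip g f := by
  simp only [ip, real_inner_comm]

lemma ip_shift {f g : Pt d n → ℂ} (hf : Per d n f) (hg : Per d n g) (k : Pt d n) :
    ip (sh k f) (sh k g) = ip f g :=
  int_shift (hf.comp₂ hg (fun a b => inner ℝ a b)) k

lemma sh_sh (a b : Pt d n) (f : Pt d n → ℂ) : sh a (sh b f) = sh (a + b) f := by
  funext z; simp [sh, add_assoc]

lemma ip_sh_sh {f : Pt d n → ℂ} (hf : Per d n f) (a b : Pt d n) :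
    ip (sh a f) (sh b f) = ip f (sh (b - a) f) := by
  have := ip_shift (g := sh (b - a) f) hf (hf.shift (b - a)) a
  rw [← this]; congr 1
  rw [sh_sh]; congr 1; abel

lemma ip_even {f : Pt d n → ℂ} (hf : Per d n f) (a : Pt d n) :
    ip f (sh (-a) f) = ip f (sh a f) := by
  have := ip_sh_sh hf a 0
  have h0 : sh 0 f = f := by funext z; simp [sh]
  rw [h0, ip_comm, zero_sub] at this
  exact this.symm

/-- Second difference. -/
def sd (h : Pt d n) (f : Pt d n → ℂ) : Pt d n → ℂ := f + f - sh h f - sh (-h) f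

lemma Good.sd {f : Pt d n → ℂ} (hf : Good d n f) (k : Pt d n) : Good d n (sd k f) :=
  ((hf.add hf).sub (hf.sh k)).sub (hf.sh (-k))

/-- First difference. -/
def fd (h : Pt d n) (f : Pt d n → ℂ) : Pt d n → ℂ := f - sh h f

lemma Good.fd {f : Pt d n → ℂ} (hf : Good d n f) (k : Pt d n) : Good d n (fd k f) :=
  hf.sub (hf.sh k)

lemma sh_zero (f : Pt d n → ℂ) : sh 0 f = f := by funext z; simp [sh]

lemma ip_sd_sd {f : Pt d n → ℂ} (hf : Good d n f) (h k : Pt d n) :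
    ip (sd h f) (sd k f) = ip (fd k (fd h f)) (fd k (fd h f)) := by
  have e : fd k (fd h f) = f - sh h f - sh k f + sh (h + k) f := by
    funext z; simp [fd, sh, add_assoc, add_comm k h]; ring
  have g1 := hf.sh h
  have g2 := hf.sh (-h)
  have g3 := hf.sh k
  have g4 := hf.sh (-k)
  have g5 := hf.sh (h + k)
  rw [e, ← inner_toLp (hf.sd h).memLp (hf.sd k).memLp,
    ← inner_toLp (((hf.sub g1).sub g3).add g5).memLp (((hf.sub g1).sub g3).add g5).memLp]
  have e1 : (hf.sd h).memLp.toLp _ = hf.memLp.toLp f + hf.memLp.toLp f - g1.memLp.toLp _ - g2.memLp.toLp _ := rfl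
  have e2 : (hf.sd k).memLp.toLp _ = hf.memLp.toLp f + hf.memLp.toLp f - g3.memLp.toLp _ - g4.memLp.toLp _ := rfl
  have e3 : (((hf.sub g1).sub g3).add g5).memLp.toLp _ = hf.memLp.toLp f - g1.memLp.toLp _ - g3.memLp.toLp _ + g5.memLp.toLp _ := rfl
  rw [e1, e2, e3]
  simp only [inner_add_left, inner_add_right, inner_sub_left, inner_sub_right, inner_toLp]
  have c0 : ∀ a b, ip (sh a f) (sh b f) = ip f (sh (b - a) f) := ip_sh_sh hf.per
  have c1 : ∀ a, ip (sh a f) f = ip f (sh a f) := fun a => ip_comm _ _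
  have ce : ∀ a, ip f (sh (-a) f) = ip f (sh a f) := ip_even hf.per
  simp only [c0, c1, ce, sub_self, sh_zero]
  have x1 : ip f (sh (k - -h) f) = ip f (sh (h + k) f) := by congr 2; abel
  have x2 : ip f (sh (-k - h) f) = ip f (sh (h + k) f) := by
    rw [← ce]; congr 2; abel
  have x3 : ip f (sh (-k - -h) f) = ip f (sh (k - h) f) := by
    rw [← ce]; congr 2; abel
  have x4 : ip f (sh (h - k) f) = ip f (sh (k - h) f) := by
    rw [← ce]; congr 2; abel
  have x5 : ip f (sh (h + k - h) f) = ip f (sh k f) := by congr 2; abel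
  have x6 : ip f (sh (h + k - k) f) = ip f (sh h f) := by congr 2; abel
  have x7 : ip f (sh (h - (h + k)) f) = ip f (sh k f) := by rw [← ce]; congr 2; abel
  have x8 : ip f (sh (k - (h + k)) f) = ip f (sh h f) := by rw [← ce]; congr 2; abel
  rw [x1, x2, x3, x4, x5, x6, x7, x8]
  ring

lemma ip_fd_fd {f : Pt d n → ℂ} (hf : Good d n f) (h : Pt d n) :
    ip (fd h f) (fd h f) = ip f (sd h f) := by
  have g1 := hf.sh h
  have g2 := hf.sh (-h)
  rw [← inner_toLp (hf.fd h).memLp (hf.fd h).memLp, ← inner_toLp hf.memLp (hf.sd h).memLp]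
  have e1 : (hf.sd h).memLp.toLp _ = hf.memLp.toLp f + hf.memLp.toLp f - g1.memLp.toLp _ - g2.memLp.toLp _ := rfl
  have e2 : (hf.fd h).memLp.toLp _ = hf.memLp.toLp f - g1.memLp.toLp _ := rfl
  rw [e1, e2]
  simp only [inner_add_right, inner_sub_left, inner_sub_right, inner_toLp]
  rw [ip_shift hf.per hf.per, ip_comm (sh h f) f, ip_even hf.per]
  ring

/-- Directional derivative. -/
def pd (e : Pt d n) (f : Pt d n → ℂ) : Pt d n → ℂ := fun z => fderiv ℝ f z e

lemma pd_sh (e k : Pt d n) (f : Pt d n → ℂ) : pd e (sh k f) = sh k (pd e f) := by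
  funext z
  change fderiv ℝ (fun z => f (z + k)) z e = fderiv ℝ f (z + k) e
  rw [fderiv_comp_add_right]

lemma contDiff_sh {f : Pt d n → ℂ} {m : WithTop ℕ∞} (hf : ContDiff ℝ m f) (k : Pt d n) :
    ContDiff ℝ m (sh k f) := hf.comp (contDiff_id.add contDiff_const)

lemma pd_fd (e k : Pt d n) {f : Pt d n → ℂ} (hf : ContDiff ℝ 1 f) :
    pd e (fd k f) = fd k (pd e f) := by
  have h1 := hf.differentiable one_ne_zero
  have h2 := (contDiff_sh hf k).differentiable one_ne_zero
  rw [fd, fd, ← pd_sh]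
  funext z
  simp only [pd, Pi.sub_apply]
  rw [fderiv_sub (h1 z) (h2 z)]; rfl

lemma pd_sd (e k : Pt d n) {f : Pt d n → ℂ} (hf : ContDiff ℝ 1 f) :
    pd e (sd k f) = sd k (pd e f) := by
  have h1 := hf.differentiable one_ne_zero
  have h2 := (contDiff_sh hf k).differentiable one_ne_zero
  have h3 := (contDiff_sh hf (-k)).differentiable one_ne_zero
  rw [sd, sd, ← pd_sh, ← pd_sh]
  funext z
  simp only [pd, Pi.sub_apply, Pi.add_apply]
  rw [fderiv_sub (((h1 z).add (h1 z)).sub (h2 z)) (h3 z), fderiv_sub ((h1 z).add (h1 z)) (h2 z),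
    fderiv_add (h1 z) (h1 z)]; rfl

lemma line_ftc {X : Type*} [NormedAddCommGroup X] [NormedSpace ℝ X] [CompleteSpace X]
    {f : Pt d n → X} (hf : ContDiff ℝ 1 f) (z e : Pt d n) :
    f (z + e) - f z = ∫ s in Ioc (0:ℝ) 1, fderiv ℝ f (z + s • e) e := by
  have hd := hf.differentiable one_ne_zero
  have hder : ∀ s : ℝ, HasDerivAt (fun s : ℝ => f (z + s • e)) (fderiv ℝ f (z + s • e) e) s := by
    intro s
    have h1 : HasDerivAt (fun s : ℝ => z + s • e) e s := by
      simpa using ((hasDerivAt_id s).smul_const e).const_add z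
    exact (hd _).hasFDerivAt.comp_hasDerivAt s h1
  have hc : Continuous (fun s : ℝ => fderiv ℝ f (z + s • e) e) := by
    have := hf.continuous_fderiv one_ne_zero
    fun_prop
  have := intervalIntegral.integral_eq_sub_of_hasDerivAt (a := 0) (b := 1) (fun s _ => hder s)
    (hc.intervalIntegrable _ _)
  rw [intervalIntegral.integral_of_le zero_le_one] at this
  rw [this]; simp

lemma ibp0 {F : Pt d n → ℝ} (hF : ContDiff ℝ 1 F) (hp : Per d n F) (e : Pt d n)
    (hi : Integrable F (μP d n)) (hi' : Integrable (fun z => fderiv ℝ F z e) (μP d n)) :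
    ∫ z, fderiv ℝ F z e ∂(μP d n) = 0 := by
  have hc : Continuous (fun z => fderiv ℝ F z e) := by
    have := hF.continuous_fderiv one_ne_zero
    fun_prop
  have h0 : ∫ z, (F (z + e) - F z) ∂(μP d n) = 0 := by
    rw [integral_sub (integrable_shift hp hF.continuous hi e) hi, int_shift hp, sub_self]
  have h1 := integrable_prod_shift (volume.restrict (Ioc (0:ℝ) 1)) (hp.fderiv e) hc hi'
    (c := fun s : ℝ => s • e) (by fun_prop)
  have h2 := integral_integral_swap (f := fun (z : Pt d n) (s : ℝ) => fderiv ℝ F (z + s • e) e) h1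
  simp only [line_ftc hF] at h0
  rw [h0] at h2
  have h3 : ∀ s : ℝ, ∫ z, fderiv ℝ F (z + s • e) e ∂(μP d n) = ∫ z, fderiv ℝ F z e ∂(μP d n) :=
    fun s => int_shift (hp.fderiv e) (s • e)
  simp only [h3] at h2
  simpa using h2.symm

lemma ibp {f g : Pt d n → ℂ} (hf : ContDiff ℝ 1 f) (hg : ContDiff ℝ 1 g) (e : Pt d n)
    (h1 : Good d n f) (h2 : Good d n g) (h3 : Good d n (pd e f)) (h4 : Good d n (pd e g)) :
    ip f (pd e g) = - ip (pd e f) g := by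
  have hd : ∀ z, fderiv ℝ (fun z => inner ℝ (f z) (g z)) z e
      = inner ℝ (f z) (pd e g z) + inner ℝ (pd e f z) (g z) := fun z => by
    rw [fderiv_inner_apply ℝ (hf.differentiable one_ne_zero z) (hg.differentiable one_ne_zero z)]
    rfl
  have i1 := integrable_ip h1.memLp h4.memLp
  have i2 := integrable_ip h3.memLp h2.memLp
  have := ibp0 (F := fun z => inner ℝ (f z) (g z)) (hf.inner ℝ hg)
    (h1.per.comp₂ h2.per (fun a b => inner ℝ a b)) e (integrable_ip h1.memLp h2.memLp)
    (by simp only [hd]; exact i1.add i2)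
  simp only [hd] at this
  rw [integral_add i1 i2] at this
  simp only [ip]; linarith

lemma sq_norm_integral_le {S : Type*} [MeasurableSpace S] (ν : Measure S) [IsProbabilityMeasure ν]
    {f : S → ℂ} (h1 : Integrable f ν) (h2 : Integrable (fun s => ‖f s‖^2) ν) :
    ‖∫ s, f s ∂ν‖^2 ≤ ∫ s, ‖f s‖^2 ∂ν := by
  set M := ∫ s, ‖f s‖ ∂ν with hM
  have h3 : ‖∫ s, f s ∂ν‖ ≤ M := norm_integral_le_integral_norm f
  have h4 : 0 ≤ ∫ s, (‖f s‖^2 - (2 * M) * ‖f s‖ + M^2) ∂ν :=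
    integral_nonneg fun s => by
      simp only [Pi.zero_apply]; nlinarith [sq_nonneg (‖f s‖ - M)]
  have h5 : Integrable (fun s => ‖f s‖^2 - (2 * M) * ‖f s‖) ν := h2.sub (h1.norm.const_mul _)
  rw [integral_add h5 (integrable_const _),
    integral_sub h2 (h1.norm.const_mul _), integral_const_mul, ← hM] at h4
  simp at h4
  nlinarith [norm_nonneg (∫ s, f s ∂ν)]

lemma fd_le {w : Pt d n → ℂ} (hw : ContDiff ℝ 1 w) (k : Pt d n) (h1 : Good d n w)
    (h2 : Good d n (pd k w)) :
    ip (fd k w) (fd k w) ≤ ip (pd k w) (pd k w) := by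
  rw [ip_self, ip_self]
  have hq : Continuous (fun z => ‖pd k w z‖^2) := h2.cont.norm.pow 2
  have hp := h2.per.comp (fun x => ‖x‖^2)
  have i1 := integrable_prod_shift (volume.restrict (Ioc (0:ℝ) 1)) hp hq h2.sq
    (c := fun s : ℝ => s • k) (by fun_prop)
  have hs := integral_integral_swap
    (f := fun (z : Pt d n) (s : ℝ) => ‖pd k w (z + s • k)‖^2) i1
  have h3 : ∀ s : ℝ, ∫ z, ‖pd k w (z + s • k)‖^2 ∂(μP d n) = ∫ z, ‖pd k w z‖^2 ∂(μP d n) :=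
    fun s => int_shift hp (s • k)
  simp only [h3] at hs
  have hs' : ∫ z, (∫ s in Ioc (0:ℝ) 1, ‖pd k w (z + s • k)‖^2) ∂(μP d n)
    = ∫ z, ‖pd k w z‖^2 ∂(μP d n) := by rw [hs]; simp
  rw [← hs']
  refine integral_mono (h1.fd k).sq i1.integral_prod_left fun z => ?_
  have : ‖fd k w z‖ = ‖∫ s in Ioc (0:ℝ) 1, pd k w (z + s • k)‖ := by
    rw [← norm_neg]
    congr 1
    have := line_ftc hw z k
    simp only [pd, ← this, fd, sh, Pi.sub_apply]; ring
  simp only [this]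
  have : IsProbabilityMeasure (volume.restrict (Ioc (0:ℝ) 1)) := ⟨by simp⟩
  have hcc : Continuous (fun s : ℝ => pd k w (z + s • k)) :=
    h2.cont.comp (by fun_prop)
  exact sq_norm_integral_le _ (hcc.integrableOn_Ioc) ((hcc.norm.pow 2).integrableOn_Ioc)

end BNLS

namespace BNLS
variable {d n : ℕ}

/-- Coordinate vectors. -/
def bas (d n : ℕ) : Fin d ⊕ Fin n → Pt d n :=
  Sum.elim (fun i => (Pi.single i 1, 0)) (fun j => (0, Pi.single j 1))

lemma pt_decomp (k : Pt d n) : k = ∑ i, (Sum.elim k.1 k.2 i) • bas d n i := by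
  refine Prod.ext ?_ ?_
  · ext i; simp [bas, Prod.fst_sum, Finset.sum_apply, Pi.single_apply]
  · ext i; simp [bas, Prod.snd_sum, Finset.sum_apply, Pi.single_apply]

lemma coef_le (k : Pt d n) (i : Fin d ⊕ Fin n) : |Sum.elim k.1 k.2 i| ≤ ‖k‖ := by
  rcases i with i | i
  · exact (norm_le_pi_norm k.1 i).trans (norm_fst_le k)
  · exact (norm_le_pi_norm k.2 i).trans (norm_snd_le k)

lemma pd_decomp (k : Pt d n) (w : Pt d n → ℂ) (z : Pt d n) :
    pd k w z = ∑ i, (Sum.elim k.1 k.2 i) • pd (bas d n i) w z := by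
  simp only [pd]
  conv_lhs => rw [pt_decomp k, map_sum]
  simp only [map_smul]

lemma Good.smul {f : Pt d n → ℂ} (hf : Good d n f) (c : ℝ) : Good d n (fun z => c • f z) :=
  Good.mk' (hf.cont.const_smul c) (hf.per.comp _) (hf.memLp.const_smul c)

lemma Good.sum {ι : Type*} (s : Finset ι) {f : ι → Pt d n → ℂ} (hf : ∀ i, Good d n (f i)) :
    Good d n (fun z => ∑ i ∈ s, f i z) :=
  Good.mk' (continuous_finsetSum s fun i _ => (hf i).cont)
    (fun g hg z => Finset.sum_congr rfl fun i _ => (hf i).per g hg z)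
    (memLp_finsetSum s fun i _ => (hf i).memLp)

lemma good_pd {w : Pt d n → ℂ} (hw : ∀ i, Good d n (pd (bas d n i) w)) (k : Pt d n) :
    Good d n (pd k w) := by
  have : pd k w = fun z => ∑ i, (Sum.elim k.1 k.2 i) • pd (bas d n i) w z := by
    funext z; exact pd_decomp k w z
  rw [this]
  exact Good.sum _ fun i => (hw i).smul _

lemma pd_le {w : Pt d n → ℂ} (hw : ∀ i, Good d n (pd (bas d n i) w)) (k : Pt d n) :
    ip (pd k w) (pd k w) ≤ (((d:ℝ)+n) * ‖k‖^2) * ∑ i, ip (pd (bas d n i) w) (pd (bas d n i) w) := by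
  simp only [ip_self]
  rw [← integral_finsetSum _ (fun i _ => (hw i).sq), ← integral_const_mul]
  refine integral_mono (good_pd hw k).sq
    ((integrable_finsetSum _ (fun i _ => (hw i).sq)).const_mul _) fun z => ?_
  simp only
  have h1 : ‖pd k w z‖ ≤ ‖k‖ * ∑ i, ‖pd (bas d n i) w z‖ := by
    rw [pd_decomp, Finset.mul_sum]
    refine (norm_sum_le _ _).trans (Finset.sum_le_sum fun i _ => ?_)
    rw [norm_smul]
    exact mul_le_mul_of_nonneg_right (coef_le k i) (norm_nonneg _)
  have h2 := sq_sum_le_card_mul_sum_sq (s := Finset.univ) (f := fun i => ‖pd (bas d n i) w z‖)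
  have h3 : ((Finset.univ : Finset (Fin d ⊕ Fin n)).card : ℝ) = (d:ℝ) + n := by simp
  rw [h3] at h2
  calc ‖pd k w z‖^2 ≤ (‖k‖ * ∑ i, ‖pd (bas d n i) w z‖)^2 := by gcongr
    _ = ‖k‖^2 * (∑ i, ‖pd (bas d n i) w z‖)^2 := by ring
    _ ≤ ‖k‖^2 * (((d:ℝ)+n) * ∑ i, ‖pd (bas d n i) w z‖^2) := by gcongr
    _ = _ := by ring

section H2
variable {u : Pt d n → ℂ}

lemma InH2.good (hu : InH2 d n u) : Good d n u := ⟨hu.1.continuous, Per.of_periodic hu.2.1, hu.2.2.1⟩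

lemma contDiff_pd (hu : ContDiff ℝ 2 u) (e : Pt d n) : ContDiff ℝ 1 (pd e u) :=
  (hu.fderiv_right (m := 1) (by norm_num)).clm_apply contDiff_const

lemma Per.pd {u : Pt d n → ℂ} (hu : Per d n u) (e : Pt d n) : Per d n (pd e u) := hu.fderiv e

lemma continuous_pd {w : Pt d n → ℂ} (hw : ContDiff ℝ 1 w) (e : Pt d n) : Continuous (pd e w) := by
  have := hw.continuous_fderiv one_ne_zero
  unfold pd
  fun_prop

lemma InH2.good_pd (hu : InH2 d n u) (i : Fin d ⊕ Fin n) : Good d n (pd (bas d n i) u) := by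
  have hc := (contDiff_pd hu.1 (bas d n i)).continuous
  refine ⟨hc, (Per.of_periodic hu.2.1).pd _, ?_⟩
  refine hu.2.2.2.1.mono' (hc.norm.pow 2).aestronglyMeasurable (Eventually.of_forall fun z => ?_)
  rw [Real.norm_of_nonneg (by positivity)]
  have : (∑ i, ‖dX d n i u z‖^2) + ∑ j, ‖dY d n j u z‖^2 = ∑ i, ‖pd (bas d n i) u z‖^2 := by
    rw [Fintype.sum_sum_type]; rfl
  rw [this]
  exact Finset.single_le_sum (f := fun i => ‖pd (bas d n i) u z‖^2) (fun i _ => by positivity)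
    (Finset.mem_univ i)

lemma InH2.good_pd2 (hu : InH2 d n u) (i : Fin d ⊕ Fin n) :
    Good d n (pd (bas d n i) (pd (bas d n i) u)) := by
  have hc := continuous_pd (contDiff_pd hu.1 (bas d n i)) (bas d n i)
  refine ⟨hc, ((Per.of_periodic hu.2.1).pd _).pd _, ?_⟩
  refine hu.2.2.2.2.mono' (hc.norm.pow 2).aestronglyMeasurable (Eventually.of_forall fun z => ?_)
  rw [Real.norm_of_nonneg (by positivity), hessInt]
  have p2 : 0 ≤ (∑ i, ∑ j, ‖dY d n j (dX d n i u) z‖^2) := by positivity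
  have p3 : 0 ≤ (∑ j, ∑ i, ‖dX d n i (dY d n j u) z‖^2) := by positivity
  rcases i with i | i
  · have p4 : 0 ≤ (∑ j, ∑ j', ‖dY d n j (dY d n j' u) z‖^2) := by positivity
    have h1 := Finset.single_le_sum (f := fun i' => ‖dX d n i (dX d n i' u) z‖^2)
      (fun i _ => by positivity) (Finset.mem_univ i)
    have h2 := Finset.single_le_sum (f := fun i => ∑ i', ‖dX d n i (dX d n i' u) z‖^2)
      (fun i _ => by positivity) (Finset.mem_univ i)
    change ‖dX d n i (dX d n i u) z‖^2 ≤ _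
    linarith
  · have p4 : 0 ≤ (∑ j, ∑ j', ‖dX d n j (dX d n j' u) z‖^2) := by positivity
    have h1 := Finset.single_le_sum (f := fun i' => ‖dY d n i (dY d n i' u) z‖^2)
      (fun i _ => by positivity) (Finset.mem_univ i)
    have h2 := Finset.single_le_sum (f := fun i => ∑ i', ‖dY d n i (dY d n i' u) z‖^2)
      (fun i _ => by positivity) (Finset.mem_univ i)
    change ‖dY d n i (dY d n i u) z‖^2 ≤ _
    linarith

lemma lap_eq : lap d n u = fun z => ∑ i, pd (bas d n i) (pd (bas d n i) u) z := by
  funext z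
  rw [Fintype.sum_sum_type]; rfl

lemma InH2.good_lap (hu : InH2 d n u) : Good d n (lap d n u) := by
  rw [lap_eq]; exact Good.sum _ hu.good_pd2

lemma InH2.good_lapX (hu : InH2 d n u) : Good d n (lapX d n u) :=
  Good.sum _ fun i => hu.good_pd2 (Sum.inl i)

lemma InH2.good_lapY (hu : InH2 d n u) : Good d n (lapY d n u) :=
  Good.sum _ fun i => hu.good_pd2 (Sum.inr i)

lemma contDiff_fd {m : WithTop ℕ∞} (hu : ContDiff ℝ m u) (h : Pt d n) : ContDiff ℝ m (fd h u) :=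
  hu.sub (contDiff_sh hu h)

lemma contDiff_sd {m : WithTop ℕ∞} (hu : ContDiff ℝ m u) (h : Pt d n) : ContDiff ℝ m (sd h u) :=
  ((hu.add hu).sub (contDiff_sh hu h)).sub (contDiff_sh hu (-h))

lemma key_ineq (hu : InH2 d n u) (h k : Pt d n) :
    ip (sd h u) (sd k u) ≤ (((d:ℝ)+n) * ‖k‖^2) * (- ip (lap d n u) (sd h u)) := by
  have hu1 : ContDiff ℝ 1 u := hu.1.of_le (by norm_num)
  have hw : ∀ i, Good d n (pd (bas d n i) (fd h u)) := fun i => by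
    rw [pd_fd _ _ hu1]; exact (hu.good_pd i).fd h
  rw [ip_sd_sd hu.good]
  refine (fd_le (contDiff_fd hu1 h) k (hu.good.fd h) (BNLS.good_pd hw k)).trans ?_
  refine (pd_le hw k).trans (le_of_eq ?_)
  congr 1
  have e : ∀ i, ip (pd (bas d n i) (fd h u)) (pd (bas d n i) (fd h u))
      = - ip (pd (bas d n i) (pd (bas d n i) u)) (sd h u) := fun i => by
    rw [pd_fd _ _ hu1, ip_fd_fd (hu.good_pd i), ← pd_sd _ _ hu1]
    exact ibp (contDiff_pd hu.1 _) (contDiff_sd hu1 h) _ (hu.good_pd i) (hu.good.sd h)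
      (hu.good_pd2 i) (by rw [pd_sd _ _ hu1]; exact (hu.good_pd i).sd h)
  simp only [e]
  rw [Finset.sum_neg_distrib, lap_eq]
  congr 1
  simp only [ip, sum_inner]
  rw [integral_finsetSum _ fun i _ => integrable_ip (hu.good_pd2 i).memLp (hu.good.sd h).memLp]

/-- Averaged second difference. -/
def avg (ν : Measure (Pt d n)) (u : Pt d n → ℂ) : Pt d n → ℂ := fun z => ∫ h, sd h u z ∂ν

lemma continuous_sd2 (hu : Continuous u) :
    Continuous (fun p : Pt d n × Pt d n => sd p.2 u p.1) := by
  simp only [sd, sh, Pi.sub_apply, Pi.add_apply]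
  fun_prop

lemma integrable_sd_sq (hu : Good d n u) (ν : Measure (Pt d n)) [IsProbabilityMeasure ν] :
    Integrable (fun p : Pt d n × Pt d n => ‖sd p.2 u p.1‖^2) ((μP d n).prod ν) := by
  have hp := hu.per.comp (fun x => ‖x‖^2)
  have hc := hu.cont.norm.pow 2
  have i0 := integrable_prod_shift ν hp hc hu.sq (c := fun _ => 0) (by fun_prop)
  have i1 := integrable_prod_shift ν hp hc hu.sq (c := fun h => h) (by fun_prop)
  have i2 := integrable_prod_shift ν hp hc hu.sq (c := fun h => -h) (by fun_prop)
  refine (((i0.const_mul 12).add (i1.const_mul 3)).add (i2.const_mul 3)).mono'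
    ((continuous_sd2 hu.cont).norm.pow 2).aestronglyMeasurable (Eventually.of_forall fun p => ?_)
  rw [Real.norm_of_nonneg (by positivity)]
  simp only [Pi.add_apply, add_zero]
  have h1 : ‖sd p.2 u p.1‖ ≤ 2 * ‖u p.1‖ + ‖u (p.1 + p.2)‖ + ‖u (p.1 + -p.2)‖ := by
    simp only [sd, sh, Pi.sub_apply, Pi.add_apply]
    calc _ ≤ ‖u p.1‖ + ‖u p.1‖ + ‖u (p.1 + p.2)‖ + ‖u (p.1 + -p.2)‖ :=
          (norm_sub_le _ _).trans (add_le_add_left ((norm_sub_le _ _).trans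
            (add_le_add_left (norm_add_le _ _) _)) _)
      _ = _ := by ring
  have h2 := pow_le_pow_left₀ (norm_nonneg _) h1 2
  nlinarith [sq_nonneg (2 * ‖u p.1‖ - ‖u (p.1 + p.2)‖), sq_nonneg (2 * ‖u p.1‖ - ‖u (p.1 + -p.2)‖),
    sq_nonneg (‖u (p.1 + p.2)‖ - ‖u (p.1 + -p.2)‖)]

variable {ν : Measure (Pt d n)} [IsProbabilityMeasure ν]

lemma avg_memLp (hu : Good d n u) (hν : ∀ f : Pt d n → ℂ, Continuous f → Integrable f ν) :
    MemLp (avg ν u) 2 (μP d n) := by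
  have hm : AEStronglyMeasurable (avg ν u) (μP d n) :=
    ((continuous_sd2 hu.cont).stronglyMeasurable.integral_prod_right (ν := ν)).aestronglyMeasurable
  refine (memLp_two_iff_integrable_sq_norm hm).2 ?_
  have hi := integrable_sd_sq hu ν
  refine hi.integral_prod_left.mono' (hm.norm.pow 2) ?_
  filter_upwards [hi.prod_right_ae] with z hz
  rw [Real.norm_of_nonneg (by positivity)]
  refine sq_norm_integral_le ν (hν _ ?_) hz
  exact (continuous_sd2 hu.cont).comp (Continuous.prodMk_right z)

lemma fub (hu : Good d n u) (hν : ∀ f : Pt d n → ℂ, Continuous f → Integrable f ν)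
    {φ : Pt d n → ℂ} (hφ : MemLp φ 2 (μP d n)) :
    Integrable (fun h => ip φ (sd h u)) ν ∧ ∫ h, ip φ (sd h u) ∂ν = ip φ (avg ν u) := by
  have hi := integrable_sd_sq hu ν
  have h1 := (memLp_two_iff_integrable_sq_norm hφ.1).1 hφ
  have hI : Integrable (fun p : Pt d n × Pt d n => inner ℝ (φ p.1) (sd p.2 u p.1))
      ((μP d n).prod ν) := by
    refine ((h1.comp_fst ν).add hi).mono'
      (hφ.1.comp_fst.inner (continuous_sd2 hu.cont).aestronglyMeasurable)
      (Eventually.of_forall fun p => ?_)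
    have := norm_inner_le_norm (𝕜 := ℝ) (φ p.1) (sd p.2 u p.1)
    simp only [Pi.add_apply]
    nlinarith [sq_nonneg (‖φ p.1‖ - ‖sd p.2 u p.1‖), sq_nonneg (‖φ p.1‖), sq_nonneg ‖sd p.2 u p.1‖]
  refine ⟨hI.integral_prod_right, ?_⟩
  have := integral_integral_swap (f := fun (z h : Pt d n) => inner ℝ (φ z) (sd h u z)) hI
  simp only [ip]
  rw [← this]
  refine integral_congr_ae (Eventually.of_forall fun z => ?_)
  simp only [avg]
  refine integral_inner (hν _ ?_) _
  exact (continuous_sd2 hu.cont).comp (Continuous.prodMk_right z)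

lemma avg_le (hu : InH2 d n u) (hν : ∀ f : Pt d n → ℂ, Continuous f → Integrable f ν)
    {ε : ℝ} (hε : ∀ᵐ k ∂ν, ‖k‖ ≤ ε) :
    ∫ z, ‖avg ν u z‖^2 ∂(μP d n) ≤ (((d:ℝ)+n) * ε^2)^2 * lapSq d n u := by
  set M := ((d:ℝ)+n) * ε^2 with hM
  have hg := avg_memLp hu.good hν
  have hlap := hu.good_lap.memLp
  have step1 : ∀ᵐ h ∂ν, ip (avg ν u) (sd h u) ≤ M * (- ip (lap d n u) (sd h u)) := by
    refine Eventually.of_forall fun h => ?_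
    have f1 := fub hu.good hν (hu.good.sd h).memLp
    rw [ip_comm, ← f1.2]
    have : ∫ _k, M * (- ip (lap d n u) (sd h u)) ∂ν = M * (- ip (lap d n u) (sd h u)) := by simp
    rw [← this]
    refine integral_mono_ae f1.1 (integrable_const _) ?_
    have hpos : 0 ≤ - ip (lap d n u) (sd h u) := by
      by_contra hneg
      push Not at hneg
      have hh := key_ineq hu h h
      rw [ip_self] at hh
      have h0 : 0 ≤ ∫ z, ‖sd h u z‖^2 ∂(μP d n) := integral_nonneg fun z => by positivity
      rcases (show (0:ℝ) ≤ ((d:ℝ)+n) * ‖h‖^2 by positivity).eq_or_lt with hz | hz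
      · rw [← hz, zero_mul] at hh
        have h00 : ip (sd h u) (sd h u) = 0 := by rw [ip_self]; linarith
        have := real_inner_mul_inner_self_le (hlap.toLp _) ((hu.good.sd h).memLp.toLp _)
        rw [inner_toLp, inner_toLp, inner_toLp, h00, mul_zero] at this
        nlinarith
      · nlinarith
    filter_upwards [hε] with k hk
    refine (key_ineq hu h k).trans ?_
    refine mul_le_mul_of_nonneg_right ?_ hpos
    rw [hM]; gcongr
  have f2 := fub hu.good hν hg
  have f3 := fub hu.good hν hlap
  have step2 : ip (avg ν u) (avg ν u) ≤ M * (- ip (lap d n u) (avg ν u)) := by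
    rw [← f2.2, ← f3.2, ← integral_neg, ← integral_const_mul]
    exact integral_mono_ae f2.1 (f3.1.neg.const_mul M) step1
  have cs := real_inner_mul_inner_self_le (hlap.toLp _) (hg.toLp _)
  rw [inner_toLp, inner_toLp, inner_toLp] at cs
  have e1 : ip (lap d n u) (lap d n u) = lapSq d n u := ip_self _
  rw [← ip_self]
  rw [e1] at cs
  set G := ip (avg ν u) (avg ν u)
  set I := ip (lap d n u) (avg ν u)
  have hG : 0 ≤ G := by
    simp only [G]; rw [ip_self]; exact integral_nonneg fun z => by positivity
  rcases hG.eq_or_lt with h0 | h0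
  · rw [← h0]
    have : 0 ≤ lapSq d n u := integral_nonneg fun z => by positivity
    positivity
  · have : G * G ≤ (M^2 * lapSq d n u) * G := by
      have a1 : G * G ≤ (M * -I) * (M * -I) := mul_self_le_mul_self hG step2
      nlinarith [mul_le_mul_of_nonneg_left cs (sq_nonneg M)]
    exact le_of_mul_le_mul_right this h0

end H2

end BNLS

namespace BNLS
variable {d n : ℕ} {u : Pt d n → ℂ}

/-- The averaging box. -/
abbrev Qb (d n : ℕ) (ε : ℝ) : Set (Pt d n) := Metric.closedBall 0 ε

lemma vol_Qb {ε : ℝ} (hε : 0 ≤ ε) :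
    (volume : Measure (Pt d n)) (Qb d n ε) = ENNReal.ofReal ((2*ε)^(d+n)) := by
  have : Qb d n ε = Metric.closedBall (0 : Fin d → ℝ) ε ×ˢ Metric.closedBall (0 : Fin n → ℝ) ε :=
    (closedBall_prod_same _ _ _).symm
  rw [this, Measure.volume_eq_prod, Measure.prod_prod, Real.volume_pi_closedBall _ hε,
    Real.volume_pi_closedBall _ hε, ← ENNReal.ofReal_mul (by positivity)]
  simp [pow_add]

/-- Uniform probability on the box. -/
def νQ (d n : ℕ) (ε : ℝ) : Measure (Pt d n) :=
  ENNReal.ofReal (((2*ε)^(d+n))⁻¹) • volume.restrict (Qb d n ε)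

lemma νQ_prob {ε : ℝ} (hε : 0 < ε) : IsProbabilityMeasure (νQ d n ε) := ⟨by
  rw [νQ, Measure.smul_apply, Measure.restrict_apply MeasurableSet.univ, univ_inter, vol_Qb hε.le,
    smul_eq_mul, ← ENNReal.ofReal_mul (by positivity), inv_mul_cancel₀ (by positivity)]
  simp⟩

lemma νQ_int {ε : ℝ} {X : Type*} [NormedAddCommGroup X] (f : Pt d n → X) (hf : Continuous f) :
    Integrable f (νQ d n ε) := by
  refine Integrable.smul_measure ?_ ENNReal.ofReal_ne_top
  exact hf.continuousOn.integrableOn_compact (isCompact_closedBall _ _)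

lemma νQ_ae {ε : ℝ} : ∀ᵐ k ∂(νQ d n ε), ‖k‖ ≤ ε := by
  refine Measure.ae_smul_measure ?_ _
  filter_upwards [ae_restrict_mem Metric.isClosed_closedBall.measurableSet] with k hk
  simpa using hk

lemma int_box_le (hu : Good d n u) {ε : ℝ} (hε1 : ε ≤ 1) (z : Pt d n) :
    ∫ h in Qb d n ε, ‖u (z + h)‖^2 ≤ Mass d n u := by
  have hg := hu.sh z
  have hper := hg.per.comp (fun x => ‖x‖^2)
  have hinv : ∀ (g : Lat d n) (x : Pt d n), ‖sh z u (g +ᵥ x)‖^2 = ‖sh z u x‖^2 :=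
    fun g x => hper g g.2 x
  set c : Pt d n := (0, fun _ => -π) with hc
  have hI : IntegrableOn (fun h => ‖sh z u h‖^2) (c +ᵥ Dom d n) volume := by
    refine ((isFund_vadd c).integrableOn_iff (isFund d n) hinv).2 ?_
    have := hg.sq
    rwa [muP_eq] at this
  have h1 : ∫ h in (c +ᵥ Dom d n), ‖sh z u h‖^2 = Mass d n u := by
    rw [(isFund_vadd c).setIntegral_eq (isFund d n) hinv, ← muP_eq, Mass]
    exact int_shift (hu.per.comp (fun x => ‖x‖^2)) z
  have h2 : Qb d n ε ⊆ c +ᵥ Dom d n := by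
    intro h hh
    rw [Set.mem_vadd_set]
    refine ⟨h - c, ⟨trivial, fun j _ => ?_⟩, by simp⟩
    have h3 : ‖h.2 j‖ ≤ 1 := by
      have : ‖h‖ ≤ ε := by simpa using hh
      exact ((norm_le_pi_norm h.2 j).trans (norm_snd_le h)).trans (this.trans hε1)
    rw [Real.norm_eq_abs, abs_le] at h3
    simp only [hc, Prod.snd_sub, Pi.sub_apply, mem_Ico]
    constructor <;> linarith [Real.pi_gt_three]
  have : ∫ h in Qb d n ε, ‖u (z + h)‖^2 = ∫ h in Qb d n ε, ‖sh z u h‖^2 := by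
    simp only [sh, add_comm]
  rw [this, ← h1]
  exact setIntegral_mono_set hI (Eventually.of_forall fun h => by positivity)
    (LE.le.eventuallyLE h2)

lemma int_box_neg {ε : ℝ} (F : Pt d n → ℝ) :
    ∫ h in Qb d n ε, F (-h) = ∫ h in Qb d n ε, F h := by
  have hm : MeasurableSet (Qb d n ε) := Metric.isClosed_closedBall.measurableSet
  have hs := Measure.integral_comp_smul (volume : Measure (Pt d n))
    (fun h => (Qb d n ε).indicator F h) (-1)
  have ha : |(((-1 : ℝ) ^ Module.finrank ℝ (Pt d n))⁻¹)| = 1 := by simp [abs_inv, abs_pow]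
  rw [ha, one_smul] at hs
  rw [← integral_indicator hm, ← integral_indicator hm, ← hs]
  congr 1
  funext h
  simp [indicator]

lemma smooth_bound (hu : Good d n u) {ε : ℝ} (hε : 0 < ε) (hε1 : ε ≤ 1) (z : Pt d n)
    {σ : ℝ} (hσ : σ = 1 ∨ σ = -1) :
    ‖∫ h, u (z + σ • h) ∂(νQ d n ε)‖^2 ≤ ((2*ε)^(d+n))⁻¹ * Mass d n u := by
  have := νQ_prob (d := d) (n := n) hε
  have hc : Continuous (fun h => u (z + σ • h)) := hu.cont.comp (by fun_prop)
  refine (sq_norm_integral_le _ (νQ_int _ hc) (νQ_int _ (hc.norm.pow 2))).trans ?_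
  rw [νQ, integral_smul_measure, ENNReal.toReal_ofReal (by positivity), smul_eq_mul]
  refine mul_le_mul_of_nonneg_left ?_ (by positivity)
  rcases hσ with rfl | rfl
  · simpa using int_box_le hu hε1 z
  · have := int_box_neg (ε := ε) (fun h => ‖u (z + h)‖^2)
    simp only [neg_smul, one_smul]
    rw [this]
    exact int_box_le hu hε1 z

lemma avg_lower (hu : Good d n u) {ε : ℝ} (hε : 0 < ε) (hε1 : ε ≤ 1) (hm : Mass d n u = 1)
    {τ : ℝ} (hτ : 0 < τ) (hτε : ((2*ε)^(d+n))⁻¹ = τ^2) (z : Pt d n) (hz : 2 * τ < ‖u z‖) :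
    2 * τ ≤ ‖avg (νQ d n ε) u z‖ := by
  have := νQ_prob (d := d) (n := n) hε
  have b1 := smooth_bound hu hε hε1 z (σ := 1) (Or.inl rfl)
  have b2 := smooth_bound hu hε hε1 z (σ := -1) (Or.inr rfl)
  rw [hm, mul_one, hτε] at b1 b2
  have c1 := abs_le_of_sq_le_sq b1 hτ.le
  have c2 := abs_le_of_sq_le_sq b2 hτ.le
  rw [abs_of_nonneg (norm_nonneg _)] at c1 c2
  simp only [one_smul, neg_smul] at c1 c2
  have i1 : Integrable (fun h => u (z + h)) (νQ d n ε) := νQ_int _ (hu.cont.comp (by fun_prop))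
  have i2 : Integrable (fun h => u (z + -h)) (νQ d n ε) := νQ_int _ (hu.cont.comp (by fun_prop))
  have e : avg (νQ d n ε) u z = (u z + u z) - ∫ h, u (z + h) ∂(νQ d n ε)
      - ∫ h, u (z + -h) ∂(νQ d n ε) := by
    simp only [avg, sd, sh, Pi.sub_apply, Pi.add_apply]
    have i0 : Integrable (fun _ : Pt d n => u z + u z) (νQ d n ε) := integrable_const _
    have i3 : Integrable (fun h => u z + u z - u (z + h)) (νQ d n ε) := i0.sub i1
    rw [integral_sub i3 i2, integral_sub i0 i1]
    simp
  rw [e]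
  have n1 : ‖u z + u z‖ = 2 * ‖u z‖ := by
    rw [← two_mul, norm_mul]; simp
  have n2 := norm_sub_norm_le (u z + u z) (∫ h, u (z + h) ∂(νQ d n ε))
  have n3 := norm_sub_norm_le (u z + u z - ∫ h, u (z + h) ∂(νQ d n ε)) (∫ h, u (z + -h) ∂(νQ d n ε))
  linarith

lemma weak_type (hd : 1 ≤ d) (hu : InH2 d n u) (hm : Mass d n u = 1) {τ : ℝ} (hτ : 1 ≤ τ) :
    (μP d n) {z | 2 * τ < ‖u z‖} ≤
      ENNReal.ofReal (((d:ℝ)+n)^2 * lapSq d n u * τ^(-(2 + 8/((d:ℝ)+n)))) := by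
  set D : ℝ := (d:ℝ)+n with hD
  have hDpos : 0 < D := by
    have : (1:ℝ) ≤ d := by exact_mod_cast hd
    positivity
  have hτ0 : 0 < τ := by linarith
  set ε : ℝ := τ^(-(2/D)) / 2 with hεd
  have hε : 0 < ε := by positivity
  have hle : τ^(-(2/D)) ≤ 1 := rpow_le_one_of_one_le_of_nonpos hτ (by
    have : 0 < 2/D := by positivity
    linarith)
  have hε1 : ε ≤ 1 := by rw [hεd]; linarith
  have hτε : ((2*ε)^(d+n))⁻¹ = τ^2 := by
    have : 2 * ε = τ^(-(2/D)) := by rw [hεd]; ring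
    rw [this, ← rpow_natCast, ← rpow_mul hτ0.le, ← rpow_neg hτ0.le, ← rpow_natCast]
    congr 1
    push_cast
    rw [← hD]; field_simp
  have hP := νQ_prob (d := d) (n := n) hε
  have hcint : ∀ f : Pt d n → ℂ, Continuous f → Integrable f (νQ d n ε) := fun f hf => νQ_int f hf
  have hL := avg_le hu hcint νQ_ae
  have hmem := avg_memLp hu.good hcint
  have hsq := (memLp_two_iff_integrable_sq_norm hmem.1).1 hmem
  have hL0 : 0 ≤ lapSq d n u := integral_nonneg fun z => by positivity
  have h1 : (μP d n) {z | 2 * τ < ‖u z‖} ≤ (μP d n) {z | ENNReal.ofReal ((2*τ)^2) ≤ ENNReal.ofReal (‖avg (νQ d n ε) u z‖^2)} := by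
    refine measure_mono fun z hz => ?_
    have := avg_lower hu.good hε hε1 hm hτ0 hτε z hz
    refine ENNReal.ofReal_le_ofReal ?_
    gcongr
  refine h1.trans ?_
  have h2 := meas_ge_le_lintegral_div (μ := μP d n) (f := fun z => ENNReal.ofReal (‖avg (νQ d n ε) u z‖^2))
    hsq.1.aemeasurable.ennreal_ofReal (ε := ENNReal.ofReal ((2*τ)^2)) (by
      rw [Ne, ENNReal.ofReal_eq_zero, not_le]; positivity) ENNReal.ofReal_ne_top
  refine h2.trans ?_
  rw [← ofReal_integral_eq_lintegral_ofReal hsq (Eventually.of_forall fun z => by positivity),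
    ← ENNReal.ofReal_div_of_pos (by positivity)]
  refine ENNReal.ofReal_le_ofReal ?_
  rw [div_le_iff₀ (by positivity)]
  refine hL.trans ?_
  rw [← hD]
  have e4 : ε^4 = τ^(-(8/D)) / 16 := by
    rw [hεd, div_pow, ← rpow_natCast, ← rpow_mul hτ0.le]
    norm_num
    congr 1; ring
  have e5 : τ^(-(2 + 8/D)) * τ^2 = τ^(-(8/D)) := by
    rw [← rpow_natCast, ← rpow_add hτ0]; congr 1; push_cast; ring
  calc (D * ε^2)^2 * lapSq d n u = D^2 * lapSq d n u * ε^4 := by ring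
    _ = D^2 * lapSq d n u * (τ^(-(8/D)) / 16) := by rw [e4]
    _ ≤ D^2 * lapSq d n u * (τ^(-(8/D)) * 4) := by
      have : 0 ≤ τ^(-(8/D)) := by positivity
      gcongr; linarith
    _ = _ := by rw [← e5]; ring

end BNLS

namespace BNLS
variable {d n : ℕ} {u : Pt d n → ℂ}

lemma cheb (hu : InH2 d n u) (hm : Mass d n u = 1) {t : ℝ} (ht : 0 < t) :
    (μP d n) {z | t < ‖u z‖} ≤ ENNReal.ofReal (t^(-2:ℝ)) := by
  have hsq := hu.good.sq
  have h1 : (μP d n) {z | t < ‖u z‖} ≤ (μP d n) {z | ENNReal.ofReal (t^2) ≤ ENNReal.ofReal (‖u z‖^2)} := by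
    refine measure_mono fun z hz => ?_
    have : t < ‖u z‖ := hz
    refine ENNReal.ofReal_le_ofReal ?_
    gcongr
  refine h1.trans ?_
  have h2 := meas_ge_le_lintegral_div (μ := μP d n) (f := fun z => ENNReal.ofReal (‖u z‖^2))
    hsq.1.aemeasurable.ennreal_ofReal (ε := ENNReal.ofReal (t^2)) (by
      rw [Ne, ENNReal.ofReal_eq_zero, not_le]; positivity) ENNReal.ofReal_ne_top
  refine h2.trans ?_
  rw [← ofReal_integral_eq_lintegral_ofReal hsq (Eventually.of_forall fun z => by positivity),
    ← ENNReal.ofReal_div_of_pos (by positivity)]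
  refine ENNReal.ofReal_le_ofReal ?_
  have : ∫ z, ‖u z‖^2 ∂(μP d n) = 1 := hm
  rw [this, rpow_neg ht.le]
  simp

lemma Npow_le (hd : 1 ≤ d) (hu : InH2 d n u) (hm : Mass d n u = 1) {α : ℝ} (hα : 0 < α)
    (hα' : α < 8 / ((d:ℝ)+n)) {T : ℝ} (hT : 2 ≤ T) :
    Npow d n (α+2) u ≤ (α+2) * (T^α/α + ((d:ℝ)+n)^2 * lapSq d n u * 2^(2+8/((d:ℝ)+n))
      * (T^(α - 8/((d:ℝ)+n)) / (8/((d:ℝ)+n) - α))) := by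
  set D : ℝ := (d:ℝ)+n with hD
  have hT0 : 0 < T := by linarith
  have hL0 : 0 ≤ lapSq d n u := integral_nonneg fun z => by positivity
  set s := 8/D with hs
  have hsα : 0 < s - α := by linarith
  set K : ℝ := D^2 * lapSq d n u * 2^(2+s) with hK
  have hK0 : 0 ≤ K := by positivity
  have hm' : AEMeasurable (fun z => ‖u z‖) (μP d n) := hu.good.cont.norm.aemeasurable
  have key := lintegral_rpow_eq_lintegral_meas_lt_mul (μP d n)
    (f := fun z => ‖u z‖) (Eventually.of_forall fun z => norm_nonneg _) hm'
    (p := α+2) (by linarith)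
  have hsplit : Ioi (0:ℝ) = Ioc 0 T ∪ Ioi T := (Ioc_union_Ioi_eq_Ioi hT0.le).symm
  have lo : ∫⁻ t in Ioc 0 T, (μP d n) {a | t < ‖u a‖} * ENNReal.ofReal (t^(α+2-1))
      ≤ ENNReal.ofReal (T^α/α) := by
    have hi : IntegrableOn (fun t : ℝ => t^(α-1)) (Ioc 0 T) := by
      have := intervalIntegral.intervalIntegrable_rpow' (a := 0) (b := T) (r := α-1) (by linarith)
      exact (intervalIntegrable_iff_integrableOn_Ioc_of_le hT0.le).1 this
    have hv : ∫ t in Ioc 0 T, t^(α-1) = T^α/α := by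
      rw [← intervalIntegral.integral_of_le hT0.le, integral_rpow (Or.inl (by linarith))]
      rw [sub_add_cancel, zero_rpow hα.ne', sub_zero]
    rw [← hv, ofReal_integral_eq_lintegral_ofReal hi ((ae_restrict_iff' measurableSet_Ioc).2
      (Eventually.of_forall fun t ht => rpow_nonneg ht.1.le _))]
    refine setLIntegral_mono' measurableSet_Ioc fun t ht => ?_
    have ht0 : 0 < t := ht.1
    refine (mul_le_mul_left (cheb hu hm ht0) _).trans_eq ?_
    rw [← ENNReal.ofReal_mul (by positivity), ← rpow_add ht0]
    congr 2; ring
  have hi' : ∫⁻ t in Ioi T, (μP d n) {a | t < ‖u a‖} * ENNReal.ofReal (t^(α+2-1))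
      ≤ ENNReal.ofReal (K * (T^(α-s)/(s-α))) := by
    have hi : IntegrableOn (fun t : ℝ => K * t^(α-s-1)) (Ioi T) :=
      (integrableOn_Ioi_rpow_of_lt (by linarith) hT0).const_mul K
    have hv : ∫ t in Ioi T, K * t^(α-s-1) = K * (T^(α-s)/(s-α)) := by
      rw [integral_const_mul, integral_Ioi_rpow_of_lt (by linarith) hT0, sub_add_cancel]
      rw [neg_div, ← div_neg, neg_sub]
    rw [← hv, ofReal_integral_eq_lintegral_ofReal hi ((ae_restrict_iff' measurableSet_Ioi).2
      (Eventually.of_forall fun t ht => by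
        have : 0 < t := hT0.trans ht
        positivity))]
    refine setLIntegral_mono' measurableSet_Ioi fun t ht => ?_
    have ht' : T < t := ht
    have ht0 : 0 < t := by linarith
    have w := weak_type hd hu hm (τ := t/2) (by linarith)
    rw [mul_div_cancel₀ t (two_ne_zero)] at w
    refine (mul_le_mul_left w _).trans_eq ?_
    rw [← ENNReal.ofReal_mul (by positivity)]
    congr 1
    rw [← hD, ← hs, hK, div_rpow ht0.le (by norm_num), rpow_neg (by norm_num : (0:ℝ) ≤ 2), div_inv_eq_mul]
    have : t^(α-s-1) = t^(-(2+s)) * t^(α+2-1) := by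
      rw [← rpow_add ht0]; congr 1; ring
    rw [this]; ring
  have tot : ∫⁻ z, ENNReal.ofReal (‖u z‖^(α+2)) ∂(μP d n) ≤
      ENNReal.ofReal ((α+2) * (T^α/α + K * (T^(α-s)/(s-α)))) := by
    rw [key, hsplit, lintegral_union measurableSet_Ioi (Ioc_disjoint_Ioi le_rfl),
      ENNReal.ofReal_mul (by linarith),
      ENNReal.ofReal_add (p := T^α/α) (by positivity) (by positivity)]
    gcongr
  rw [Npow, integral_eq_lintegral_of_nonneg_ae (Eventually.of_forall fun z => by positivity)
    (hm'.pow_const _).aestronglyMeasurable]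
  exact ENNReal.toReal_le_of_le_ofReal (by positivity) tot

lemma lapSq_le (hu : InH2 d n u) : lapSq d n u ≤ 2 * (lapXSq d n u + lapYSq d n u) := by
  have hX := hu.good_lapX.sq
  have hY := hu.good_lapY.sq
  rw [lapXSq, lapYSq, ← integral_add hX hY, ← integral_const_mul]
  refine integral_mono hu.good_lap.sq ((hX.add hY).const_mul 2) fun z => ?_
  have := norm_add_le (lapX d n u z) (lapY d n u z)
  have h2 : ‖lap d n u z‖ ≤ ‖lapX d n u z‖ + ‖lapY d n u z‖ := this
  have h3 : ‖lap d n u z‖^2 ≤ (‖lapX d n u z‖ + ‖lapY d n u z‖)^2 := by gcongr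
  change ‖lap d n u z‖^2 ≤ 2 * (‖lapX d n u z‖^2 + ‖lapY d n u z‖^2)
  nlinarith [sq_nonneg (‖lapX d n u z‖ - ‖lapY d n u z‖)]

lemma bddBelow_E (hd : 1 ≤ d) {α lam : ℝ} (hα : 0 < α) (hα' : α < 8 / ((d:ℝ)+n)) (hlam : 0 < lam) :
    BddBelow (Elam d n lam α '' Sset d n 1) := by
  set D : ℝ := (d:ℝ)+n with hD
  set s := 8/D with hs
  have hsα : 0 < s - α := by linarith
  set C : ℝ := D^2 * 2^(2+s) / (s-α) with hC
  have hC0 : 0 ≤ C := by positivity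
  have hlim : Tendsto (fun T : ℝ => C * T^(-(s-α))) atTop (nhds (C * 0)) :=
    (tendsto_rpow_neg_atTop hsα).const_mul C
  rw [mul_zero] at hlim
  have hδ : 0 < min lam 1 / 4 := by positivity
  obtain ⟨T, hT, hT2⟩ := ((hlim.eventually (gt_mem_nhds hδ)).and (eventually_ge_atTop 2)).exists
  refine ⟨-(T^α/α), ?_⟩
  rintro _ ⟨u, ⟨hu, hm⟩, rfl⟩
  have h1 := Npow_le hd hu hm hα hα' hT2
  rw [← hD, ← hs] at h1
  have h2 := lapSq_le hu
  have hL0 : 0 ≤ lapSq d n u := integral_nonneg fun z => by positivity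
  have hX0 : 0 ≤ lapXSq d n u := integral_nonneg fun z => by positivity
  have hY0 : 0 ≤ lapYSq d n u := integral_nonneg fun z => by positivity
  have h3 : (1/(α+2)) * Npow d n (α+2) u ≤ T^α/α + (C * T^(-(s-α))) * lapSq d n u := by
    rw [one_div, inv_mul_le_iff₀ (by linarith)]
    refine h1.trans_eq ?_
    rw [hC, show -(s-α) = α - s by ring]
    ring
  have h4 : (C * T^(-(s-α))) * lapSq d n u ≤ min lam 1 / 4 * (2 * (lapXSq d n u + lapYSq d n u)) :=
    mul_le_mul hT.le h2 hL0 hδ.le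
  have h5 : min lam 1 ≤ lam := min_le_left _ _
  have h6 : min lam 1 ≤ 1 := min_le_right _ _
  rw [Elam]
  nlinarith [mul_le_mul_of_nonneg_right h5 hY0, mul_le_mul_of_nonneg_right h6 hX0]

end BNLS

namespace BNLS
variable {d n : ℕ} {u : Pt d n → ℂ}

/-- The dilation `(x,y) ↦ (t x, y)`. -/
def Sc (d n : ℕ) (t : ℝ) : Pt d n →L[ℝ] Pt d n :=
  (t • ContinuousLinearMap.id ℝ (Fin d → ℝ)).prodMap (ContinuousLinearMap.id ℝ (Fin n → ℝ))

lemma Sc_apply (t : ℝ) (z : Pt d n) : Sc d n t z = (t • z.1, z.2) := rfl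

instance : SFinite (μT n) := by unfold μT; infer_instance

lemma map_Sc {t : ℝ} (ht : 0 < t) :
    Measure.map (Sc d n t) (μP d n) = ENNReal.ofReal ((t^d)⁻¹) • μP d n := by
  have h0 : (Sc d n t : Pt d n → Pt d n) = Prod.map (fun x => t • x) id := rfl
  have h1 := Measure.map_addHaar_smul (volume : Measure (Fin d → ℝ)) ht.ne'
  rw [Module.finrank_fin_fun, abs_of_pos (by positivity)] at h1
  rw [h0, μP, ← Measure.map_prod_map _ _ (measurable_const_smul t) measurable_id, h1, Measure.map_id,
    Measure.prod_smul_left]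

lemma int_Sc {t : ℝ} (ht : 0 < t) {F : Pt d n → ℝ} (hF : Continuous F) :
    ∫ z, F (Sc d n t z) ∂(μP d n) = (t^d)⁻¹ * ∫ z, F z ∂(μP d n) := by
  rw [← integral_map (φ := Sc d n t) (Sc d n t).continuous.aemeasurable hF.aestronglyMeasurable, map_Sc ht,
    integral_smul_measure, ENNReal.toReal_ofReal (by positivity), smul_eq_mul]

lemma integrable_Sc {t : ℝ} (ht : 0 < t) {F : Pt d n → ℝ} (hF : Integrable F (μP d n)) :
    Integrable (fun z => F (Sc d n t z)) (μP d n) := by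
  refine Integrable.comp_measurable (g := F) ?_ (Sc d n t).continuous.measurable
  rw [map_Sc ht]
  exact hF.smul_measure ENNReal.ofReal_ne_top

/-- Rescaled function. -/
def scu (t c : ℝ) (u : Pt d n → ℂ) : Pt d n → ℂ := fun z => c • u (Sc d n t z)

lemma pd_scu {u : Pt d n → ℂ} (hu : ContDiff ℝ 1 u) (t c : ℝ) (e : Pt d n) :
    pd e (scu t c u) = scu t c (pd (Sc d n t e) u) := by
  funext z
  have h1 : HasFDerivAt u (fderiv ℝ u (Sc d n t z)) (Sc d n t z) :=
    ((hu.differentiable one_ne_zero) _).hasFDerivAt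
  have h2 := (h1.comp z (Sc d n t).hasFDerivAt).const_smul c
  have h3 : fderiv ℝ (scu t c u) z = c • (fderiv ℝ u (Sc d n t z)).comp (Sc d n t) := h2.fderiv
  simp only [pd, scu, h3]
  rfl

lemma dX_scu {u : Pt d n → ℂ} (hu : ContDiff ℝ 1 u) (t c : ℝ) (i : Fin d) :
    dX d n i (scu t c u) = scu t (c*t) (dX d n i u) := by
  have := pd_scu hu t c (Pi.single i 1, 0)
  refine this.trans ?_
  funext z
  have : Sc d n t (Pi.single i 1, 0) = t • ((Pi.single i 1, 0) : Pt d n) := by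
    rw [Sc_apply]; ext <;> simp
  simp only [scu, pd, dX, this, map_smul, smul_smul]

lemma dY_scu {u : Pt d n → ℂ} (hu : ContDiff ℝ 1 u) (t c : ℝ) (i : Fin n) :
    dY d n i (scu t c u) = scu t c (dY d n i u) := by
  have := pd_scu hu t c (0, Pi.single i 1)
  refine this.trans ?_
  funext z
  have : Sc d n t (0, Pi.single i 1) = ((0, Pi.single i 1) : Pt d n) := by
    rw [Sc_apply]; ext <;> simp
  simp only [scu, pd, dY, this]

lemma norm_scu (t c : ℝ) (u : Pt d n → ℂ) (z : Pt d n) :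
    ‖scu t c u z‖^2 = c^2 * ‖u (Sc d n t z)‖^2 := by
  simp [scu, norm_smul, mul_pow]

lemma sq_scu {t : ℝ} (ht : 0 < t) (c : ℝ) (hu : Continuous u) :
    ∫ z, ‖scu t c u z‖^2 ∂(μP d n) = c^2 * (t^d)⁻¹ * ∫ z, ‖u z‖^2 ∂(μP d n) := by
  simp only [norm_scu]
  rw [integral_const_mul, int_Sc ht (F := fun z => ‖u z‖^2) (hu.norm.pow 2), mul_assoc]

lemma integrable_scu {t : ℝ} (ht : 0 < t) (c : ℝ) (hu : Integrable (fun z => ‖u z‖^2) (μP d n)) :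
    Integrable (fun z => ‖scu t c u z‖^2) (μP d n) := by
  simp only [norm_scu]
  exact (integrable_Sc ht (F := fun z => ‖u z‖^2) hu).const_mul _

lemma cont_of_term {F : Pt d n → ℝ} {f : Pt d n → ℂ} (hF : Integrable F (μP d n)) (hf : Continuous f)
    (h : ∀ z, ‖f z‖^2 ≤ F z) : Integrable (fun z => ‖f z‖^2) (μP d n) :=
  hF.mono' (hf.norm.pow 2).aestronglyMeasurable (Eventually.of_forall fun z => by
    rw [Real.norm_eq_abs, abs_of_nonneg (by positivity)]; exact h z)

lemma single_le₁ {ι : Type*} [Fintype ι] (f : ι → ℝ) (hf : ∀ i, 0 ≤ f i) (i : ι) :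
    f i ≤ ∑ i, f i := Finset.single_le_sum (fun i _ => hf i) (Finset.mem_univ i)

lemma single_le₂ {ι κ : Type*} [Fintype ι] [Fintype κ] (f : ι → κ → ℝ) (hf : ∀ i j, 0 ≤ f i j)
    (i : ι) (j : κ) : f i j ≤ ∑ i, ∑ j, f i j :=
  (single_le₁ (f i) (hf i) j).trans
    (single_le₁ (fun i => ∑ j, f i j) (fun i => Finset.sum_nonneg fun j _ => hf i j) i)

lemma cd_dX (hu : ContDiff ℝ 2 u) (i : Fin d) : ContDiff ℝ 1 (dX d n i u) := contDiff_pd hu _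
lemma cd_dY (hu : ContDiff ℝ 2 u) (i : Fin n) : ContDiff ℝ 1 (dY d n i u) := contDiff_pd hu _
lemma c_dX (hu : ContDiff ℝ 1 u) (i : Fin d) : Continuous (dX d n i u) := continuous_pd hu _
lemma c_dY (hu : ContDiff ℝ 1 u) (i : Fin n) : Continuous (dY d n i u) := continuous_pd hu _

lemma InH2.scu (hu : InH2 d n u) {t : ℝ} (ht : 0 < t) (c : ℝ) : InH2 d n (scu t c u) := by
  have hc2 := hu.1
  have hc1 : ContDiff ℝ 1 u := hu.1.of_le (by norm_num)
  obtain ⟨_, hper, hM, hG, hH⟩ := hu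
  refine ⟨?_, ?_, integrable_scu ht c hM, ?_, ?_⟩
  · exact (hc2.comp (Sc d n t).contDiff).const_smul c
  · intro j p
    have := hper j (Sc d n t p)
    simp only [BNLS.scu, Sc_apply] at this ⊢
    rw [this]
  · simp only [dX_scu hc1, dY_scu hc1]
    refine (integrable_finsetSum _ fun i _ => integrable_scu ht _ ?_).add
      (integrable_finsetSum _ fun i _ => integrable_scu ht _ ?_)
    · refine cont_of_term hG (c_dX hc1 i) fun z => ?_
      have := single_le₁ (fun i => ‖dX d n i u z‖^2) (fun i => by positivity) i
      have : 0 ≤ ∑ j, ‖dY d n j u z‖^2 := by positivity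
      linarith
    · refine cont_of_term hG (c_dY hc1 i) fun z => ?_
      have := single_le₁ (fun i => ‖dY d n i u z‖^2) (fun i => by positivity) i
      have : 0 ≤ ∑ j, ‖dX d n j u z‖^2 := by positivity
      linarith
  · have e : hessInt d n (BNLS.scu t c u) = fun z =>
      (∑ i, ∑ i', ‖BNLS.scu t (c*t*t) (dX d n i (dX d n i' u)) z‖^2)
      + (∑ i, ∑ j, ‖BNLS.scu t (c*t) (dY d n j (dX d n i u)) z‖^2)
      + (∑ j, ∑ i, ‖BNLS.scu t (c*t) (dX d n i (dY d n j u)) z‖^2)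
      + (∑ j, ∑ j', ‖BNLS.scu t c (dY d n j (dY d n j' u)) z‖^2) := by
      funext z
      simp only [hessInt, dX_scu hc1, dY_scu hc1, dX_scu (cd_dX hc2 _), dY_scu (cd_dX hc2 _),
        dX_scu (cd_dY hc2 _), dY_scu (cd_dY hc2 _)]
    rw [e]
    have n1 : ∀ z, 0 ≤ ∑ i, ∑ i', ‖dX d n i (dX d n i' u) z‖^2 := fun z => by positivity
    have n2 : ∀ z, 0 ≤ ∑ i, ∑ j, ‖dY d n j (dX d n i u) z‖^2 := fun z => by positivity
    have n3 : ∀ z, 0 ≤ ∑ j, ∑ i, ‖dX d n i (dY d n j u) z‖^2 := fun z => by positivity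
    have n4 : ∀ z, 0 ≤ ∑ j, ∑ j', ‖dY d n j (dY d n j' u) z‖^2 := fun z => by positivity
    refine (((integrable_finsetSum _ fun i _ => integrable_finsetSum _ fun j _ =>
        integrable_scu ht _ ?_).add
      (integrable_finsetSum _ fun i _ => integrable_finsetSum _ fun j _ =>
        integrable_scu ht _ ?_)).add
      (integrable_finsetSum _ fun i _ => integrable_finsetSum _ fun j _ =>
        integrable_scu ht _ ?_)).add
      (integrable_finsetSum _ fun i _ => integrable_finsetSum _ fun j _ =>
        integrable_scu ht _ ?_)
    · refine cont_of_term hH (c_dX (cd_dX hc2 _) _) fun z => ?_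
      have := single_le₂ (fun i i' => ‖dX d n i (dX d n i' u) z‖^2) (fun i j => by positivity) i j
      simp only [hessInt] at *
      linarith [n1 z, n2 z, n3 z, n4 z]
    · refine cont_of_term hH (c_dY (cd_dX hc2 _) _) fun z => ?_
      have := single_le₂ (fun i j => ‖dY d n j (dX d n i u) z‖^2) (fun i j => by positivity) i j
      simp only [hessInt] at *
      linarith [n1 z, n2 z, n3 z, n4 z]
    · refine cont_of_term hH (c_dX (cd_dY hc2 _) _) fun z => ?_
      have := single_le₂ (fun j i => ‖dX d n i (dY d n j u) z‖^2) (fun i j => by positivity) i j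
      simp only [hessInt] at *
      linarith [n1 z, n2 z, n3 z, n4 z]
    · refine cont_of_term hH (c_dY (cd_dY hc2 _) _) fun z => ?_
      have := single_le₂ (fun i i' => ‖dY d n i (dY d n i' u) z‖^2) (fun i j => by positivity) i j
      simp only [hessInt] at *
      linarith [n1 z, n2 z, n3 z, n4 z]

lemma lapX_scu (hu : ContDiff ℝ 2 u) (t c : ℝ) :
    lapX d n (scu t c u) = scu t (c*t*t) (lapX d n u) := by
  funext z
  simp only [lapX, dX_scu (hu.of_le (by norm_num : (1 : WithTop ℕ∞) ≤ 2)), dX_scu (cd_dX hu _)]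
  exact Finset.smul_sum.symm

lemma lapY_scu (hu : ContDiff ℝ 2 u) (t c : ℝ) :
    lapY d n (scu t c u) = scu t c (lapY d n u) := by
  funext z
  simp only [lapY, dY_scu (hu.of_le (by norm_num : (1 : WithTop ℕ∞) ≤ 2)), dY_scu (cd_dY hu _)]
  exact Finset.smul_sum.symm

lemma E_scu (hu : InH2 d n u) (hm : Mass d n u = 1) {t : ℝ} (ht : 0 < t) (α lam : ℝ) (hα : 0 < α) :
    scu t (t^((d:ℝ)/2)) u ∈ Sset d n 1 ∧ Elam d n lam α (scu t (t^((d:ℝ)/2)) u) =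
      (lam/2) * lapYSq d n u + (1/2) * (t^4 * lapXSq d n u)
        - (1/(α+2)) * (t^(d*α/2) * Npow d n (α+2) u) := by
  set c : ℝ := t^((d:ℝ)/2) with hc
  have hc2 : c^2 = t^d := by
    rw [hc, ← rpow_natCast, ← rpow_mul ht.le, ← rpow_natCast]; congr 1; push_cast; ring
  have htd : t^d ≠ 0 := by positivity
  refine ⟨⟨hu.scu ht c, ?_⟩, ?_⟩
  · rw [Mass, sq_scu ht c hu.good.cont, hc2, mul_inv_cancel₀ htd, one_mul]; exact hm
  · have hY : lapYSq d n (scu t c u) = lapYSq d n u := by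
      rw [lapYSq, lapY_scu hu.1, sq_scu ht c hu.good_lapY.cont, hc2, mul_inv_cancel₀ htd, one_mul]; rfl
    have hX : lapXSq d n (scu t c u) = t^4 * lapXSq d n u := by
      rw [lapXSq, lapX_scu hu.1, sq_scu ht _ hu.good_lapX.cont, mul_pow, mul_pow, hc2]
      rw [show t^d * t^2 * t^2 * (t^d)⁻¹ = t^4 * (t^d * (t^d)⁻¹) by ring, mul_inv_cancel₀ htd, mul_one]; rfl
    have hN : Npow d n (α+2) (scu t c u) = t^(d*α/2) * Npow d n (α+2) u := by
      have e : ∀ z, ‖scu t c u z‖^(α+2) = c^(α+2) * ‖u (Sc d n t z)‖^(α+2) := fun z => by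
        rw [scu, norm_smul, Real.norm_of_nonneg (by positivity), mul_rpow (by positivity) (norm_nonneg _)]
      rw [Npow]
      simp only [e]
      rw [integral_const_mul, int_Sc ht (F := fun z => ‖u z‖^(α+2))
        (hu.good.cont.norm.rpow_const fun _ => Or.inr (by linarith)), ← mul_assoc]
      congr 1
      rw [hc, ← rpow_mul ht.le, ← rpow_natCast, ← rpow_neg ht.le, ← rpow_add ht]
      congr 1; ring
    rw [Elam, hY, hX, hN]

end BNLS

end

open BNLS in
/-- the Pohozaev identity `2‖Δ_x u_λ‖₂² = (αd/(2(α+2)))‖u_λ‖_{α+2}^{α+2}`. -/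
theorem stmt_15 (d n : ℕ) (hd : 1 ≤ d) (hn : 1 ≤ n) (α lam : ℝ)
    (hα : 0 < α) (hα' : α < 8 / ((d:ℝ)+n)) (hlam : 0 < lam)
    (u : Pt d n → ℂ) (hu : u ∈ Sset d n 1)
    (hmin : Elam d n lam α u = m1lam d n lam α) :
    2 * lapXSq d n u = (α * d / (2 * (α+2))) * Npow d n (α+2) u := by
  have hb := bddBelow_E (n := n) hd hα hα' hlam
  set L := lapXSq d n u with hL
  set N := Npow d n (α+2) u with hN
  let f : ℝ → ℝ := fun t => (lam/2) * lapYSq d n u + (1/2) * (t^4 * L) - (1/(α+2)) * (t^(d*α/2) * N)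
  have h1 : f 1 = Elam d n lam α u := by simp [f, Elam, ← hL, ← hN]
  have hloc : IsLocalMin f 1 := by
    filter_upwards [lt_mem_nhds (zero_lt_one' ℝ)] with t ht
    obtain ⟨hS, hE⟩ := E_scu hu.1 hu.2 ht α lam hα
    rw [h1, hmin, m1lam]
    have : f t = Elam d n lam α (scu t (t^((d:ℝ)/2)) u) := hE.symm
    rw [this]
    exact csInf_le hb ⟨_, hS, rfl⟩
  have hder : HasDerivAt f (0 + (1/2) * ((4:ℕ) * (1:ℝ)^(4-1) * L) - (1/(α+2)) * ((d*α/2) * (1:ℝ)^(d*α/2-1) * N)) 1 := by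
    have a1 := ((hasDerivAt_pow 4 (1:ℝ)).mul_const L).const_mul (1/2)
    have a2 := ((Real.hasDerivAt_rpow_const (x := 1) (p := d*α/2) (Or.inl one_ne_zero)).mul_const N).const_mul (1/(α+2))
    exact ((hasDerivAt_const (1:ℝ) ((lam/2) * lapYSq d n u)).add a1).sub a2
  have h0 := hloc.hasDerivAt_eq_zero hder
  simp only [one_pow, one_rpow] at h0
  have : α + 2 ≠ 0 := by linarith
  push_cast at h0
  field_simp at h0 ⊢
  linarith
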